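/- For any integer k with |k| ≥ 2 and any n ≥ |k|, there exists a triangulated n-sphere K with |k| + n + 3 vertices and a simplicial map f : K → S^n_{n+2} of degree k. -/

import Mathlib

open Finset

/-- An abstract simplicial complex on vertex type `V`: a collection of nonempty
finite sets of vertices closed under taking nonempty subsets. -/
structure AbsCx (V : Type*) where
  faces : Set (Finset V)
  down_closed : ∀ ⦃s t : Finset V⦄, s ∈ faces → t ⊆ s → t.Nonempty → t ∈ faces
  nonempty_of_mem : ∀ ⦃s⦄, s ∈ faces → s.Nonempty

namespace AbsCx

variable {V W : Type*}

/-- The vertices of a complex. -/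
def vertexSet (K : AbsCx V) : Set V := {v | {v} ∈ K.faces}

/-- The `n`-dimensional faces (given by `n+1` vertices). -/
def facetsOfDim (K : AbsCx V) (n : ℕ) : Set (Finset V) :=
  {s | s ∈ K.faces ∧ s.card = n + 1}

/-- A simplicial map sends faces to faces. -/
def IsSimplicialMap [DecidableEq W] (K : AbsCx V) (L : AbsCx W) (f : V → W) : Prop :=
  ∀ s ∈ K.faces, s.image f ∈ L.faces

/-- Geometric realization of an abstract simplicial complex, as a subspace of `V → ℝ`. -/
def realization (K : AbsCx V) : Set (V → ℝ) :=
  {g | (∀ v, 0 ≤ g v) ∧ ∃ s ∈ K.faces, (∀ v, v ∉ s → g v = 0) ∧ ∑ v ∈ s, g v = 1}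

/-- `K` is a triangulation of the `n`-sphere. -/
def IsSphereTriangulation (n : ℕ) (K : AbsCx V) : Prop :=
  Nonempty (K.realization ≃ₜ Metric.sphere (0 : EuclideanSpace ℝ (Fin (n+1))) 1)

/-- `K` is a triangulation of the closed `n`-disc. -/
def IsDiscTriangulation (n : ℕ) (K : AbsCx V) : Prop :=
  Nonempty (K.realization ≃ₜ Metric.closedBall (0 : EuclideanSpace ℝ (Fin n)) 1)

/-- `K` triangulates a closed (compact, boundaryless = locally Euclidean) topological
`n`-manifold. -/
def IsClosedManifoldTriangulation (n : ℕ) (K : AbsCx V) : Prop :=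
  ∃ (M : Type) (ts : TopologicalSpace M),
    @CompactSpace M ts ∧ Nonempty (@ChartedSpace (EuclideanSpace ℝ (Fin n)) _ M ts) ∧
      Nonempty (@Homeomorph (K.realization) M _ ts)

/-- A coherent orientation of the `n`-dimensional faces of `K`: a sign function on
ordered `(n+1)`-tuples of vertices, alternating under permutations, equal to `±1`
exactly on the orderings of `n`-faces, and such that two facets sharing an
`(n-1)`-face (i.e. orderings differing in exactly one coordinate) get opposite signs. -/
structure CoherentOrientation [DecidableEq V] (n : ℕ) (K : AbsCx V) where
  sign : (Fin (n+1) → V) → ℤ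
  sign_perm : ∀ (x : Fin (n+1) → V) (σ : Equiv.Perm (Fin (n+1))),
    sign (x ∘ σ) = (Equiv.Perm.sign σ : ℤ) * sign x
  sign_unit : ∀ x : Fin (n+1) → V, Function.Injective x →
    Finset.image x Finset.univ ∈ K.faces → sign x = 1 ∨ sign x = -1
  sign_zero : ∀ x : Fin (n+1) → V,
    ¬ Function.Injective x ∨ Finset.image x Finset.univ ∉ K.faces → sign x = 0
  coherent : ∀ x y : Fin (n+1) → V,
    (∃ i, x i ≠ y i ∧ ∀ j, j ≠ i → x j = y j) →
    sign x ≠ 0 → sign y ≠ 0 → sign y = - sign x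

open scoped Classical in
/-- The algebraic number of preimages of the ordered simplex `y` under `f`. -/
noncomputable def algSum [Fintype V] {n : ℕ}
    (sgn : (Fin (n+1) → V) → ℤ) (f : V → W) (y : Fin (n+1) → W) : ℤ :=
  ∑ x : Fin (n+1) → V, if f ∘ x = y then sgn x else 0

/-- `f` has degree `d`: the algebraic number of preimages of every positively
oriented facet of the target equals `d`. -/
def HasDegree [Fintype V] [DecidableEq V] [DecidableEq W] {n : ℕ}
    {K : AbsCx V} {L : AbsCx W}
    (oK : CoherentOrientation n K) (oL : CoherentOrientation n L)
    (f : V → W) (d : ℤ) : Prop :=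
  ∀ y : Fin (n+1) → W, oL.sign y = 1 → algSum oK.sign f y = d

/-- The standard `n`-sphere `S^n_{n+2}`: the boundary complex of the `(n+1)`-simplex,
i.e. all proper nonempty subsets of `n+2` vertices. -/
def stdSphere (n : ℕ) : AbsCx (Fin (n+2)) where
  faces := {s | s.Nonempty ∧ s ≠ Finset.univ}
  down_closed := fun {s t} hs hts ht =>
    ⟨ht, fun h => hs.2 (Finset.univ_subset_iff.mp (h ▸ hts))⟩
  nonempty_of_mem := fun {s} hs => hs.1

/-- Boundary edges of a 2-dimensional complex: edges lying in exactly one triangle. -/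
def boundaryEdges (K : AbsCx V) : Set (Finset V) :=
  {e | e ∈ K.faces ∧ e.card = 2 ∧ Set.ncard {s | s ∈ K.faces ∧ s.card = 3 ∧ e ⊆ s} = 1}

end AbsCx

open AbsCx


namespace Constr

/-- The alternating form `v ↦ det (1, v_0, …, v_n)`. -/
noncomputable def alt (n : ℕ) : (Fin (n+2) → ℤ) [⋀^Fin (n+1)]→ₗ[ℤ] ℤ :=
  (Matrix.detRowAlternating (n := Fin (n+2)) (R := ℤ)).curryLeft (fun _ => 1)

/-- Orientation form on tuples of colours. -/
noncomputable def D (n : ℕ) (y : Fin (n+1) → Fin (n+2)) : ℤ :=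
  alt n (fun i => Pi.single (y i) 1)

theorem D_perm {n : ℕ} (y : Fin (n+1) → Fin (n+2)) (σ : Equiv.Perm (Fin (n+1))) :
    D n (y ∘ σ) = (Equiv.Perm.sign σ : ℤ) * D n y := by
  have := (alt n).map_perm (fun i => Pi.single (y i) 1) σ
  simp only [D]
  rw [show (fun i => (Pi.single ((y ∘ σ) i) 1 : Fin (n+2) → ℤ))
    = (fun i => Pi.single (y i) 1) ∘ σ from rfl, this]
  simp [Units.smul_def]

theorem D_zero {n : ℕ} (y : Fin (n+1) → Fin (n+2)) (h : ¬ Function.Injective y) :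
    D n y = 0 := by
  simp only [Function.Injective, not_forall] at h
  obtain ⟨i, j, hij, hne⟩ := h
  exact (alt n).map_eq_zero_of_eq _ (by simp only [hij]) hne

theorem exists_missing {n : ℕ} (y : Fin (n+1) → Fin (n+2)) (h : Function.Injective y) :
    ∃ j, (∀ i, y i ≠ j) ∧ ∀ k, k ≠ j → ∃ i, y i = k := by
  have h1 : (Finset.image y Finset.univ).card = n + 1 := by
    rw [Finset.card_image_of_injective _ h]; simp
  have h2 : (Finset.image y Finset.univ)ᶜ.card = 1 := by
    rw [Finset.card_compl, h1]; simp
  obtain ⟨j, hj⟩ := Finset.card_eq_one.mp h2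
  refine ⟨j, ?_, ?_⟩
  · intro i hi
    have : j ∈ (Finset.image y Finset.univ)ᶜ := by rw [hj]; simp
    simp at this
    exact this i hi
  · intro k hk
    by_contra hc
    have : k ∈ (Finset.image y Finset.univ)ᶜ := by simpa using hc
    rw [hj] at this
    exact hk (by simpa using this)

theorem D_unit {n : ℕ} (y : Fin (n+1) → Fin (n+2)) (h : Function.Injective y) :
    D n y = 1 ∨ D n y = -1 := by
  obtain ⟨j, hj, hj'⟩ := exists_missing y h
  have h1 : (fun _ => 1 : Fin (n+2) → ℤ) = Pi.single j 1 + ∑ i, Pi.single (y i) 1 := by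
    funext k
    simp only [Pi.add_apply, Finset.sum_apply]
    by_cases hk : k = j
    · subst hk
      rw [Finset.sum_eq_zero]
      · simp
      · intro i _
        exact Pi.single_eq_of_ne (hj i).symm _
    · obtain ⟨i, rfl⟩ := hj' k hk
      rw [Finset.sum_eq_single i]
      · simp [Pi.single_eq_of_ne hk]
      · intro i' _ hi'
        exact Pi.single_eq_of_ne (fun e => hi' (h e.symm)) _
      · simp
  have hbij : Function.Bijective (Fin.cons j y : Fin (n+2) → Fin (n+2)) := by
    rw [← Finite.injective_iff_bijective]
    exact Fin.cons_injective_iff.mpr ⟨by rintro ⟨i, hi⟩; exact hj i hi, h⟩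
  have h2 : D n y = Matrix.det ((Equiv.ofBijective _ hbij).toPEquiv.toMatrix) := by
    let F : (Fin (n+2) → ℤ) →ₗ[ℤ] ℤ :=
      { toFun := fun c => (Matrix.detRowAlternating (n := Fin (n+2)) (R := ℤ)).curryLeft c
          (fun i => Pi.single (y i) 1)
        map_add' := fun a b => by rw [map_add, AlternatingMap.add_apply]
        map_smul' := fun a b => by rw [map_smul, AlternatingMap.smul_apply]; rfl }
    change F (fun _ => 1) = _
    rw [h1, map_add, map_sum, Finset.sum_eq_zero, add_zero]
    · change (Matrix.detRowAlternating (n := Fin (n+2)) (R := ℤ)).curryLeft _ _ = _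
      rw [AlternatingMap.curryLeft_apply_apply]
      change Matrix.det _ = Matrix.det _
      congr 1
      funext a b
      refine Fin.cases ?_ (fun i => ?_) a
      · simp [PEquiv.toMatrix_apply, Matrix.vecCons, Pi.single_apply, eq_comm]
      · simp [PEquiv.toMatrix_apply, Matrix.vecCons, Pi.single_apply, eq_comm]
    · intro i _
      change (Matrix.detRowAlternating (n := Fin (n+2)) (R := ℤ)).curryLeft _ _ = _
      rw [AlternatingMap.curryLeft_apply_apply]
      refine AlternatingMap.map_eq_zero_of_eq _ _ (i := 0) (j := i.succ) ?_ (Fin.succ_ne_zero i).symm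
      simp [Matrix.vecCons]
  rw [h2, Matrix.det_permutation]
  rcases Int.units_eq_one_or (Equiv.Perm.sign (Equiv.ofBijective _ hbij)) with h | h <;> simp [h]

theorem D_coh {n : ℕ} (x y : Fin (n+1) → Fin (n+2)) (hx : Function.Injective x)
    (hy : Function.Injective y) (i : Fin (n+1)) (hi : x i ≠ y i) (hij : ∀ j, j ≠ i → x j = y j) :
    D n y = - D n x := by
  have h1 : (fun _ => 1 : Fin (n+2) → ℤ) =
      Pi.single (x i) 1 + ∑ j, Pi.single (y j) 1 := by
    funext k
    simp only [Pi.add_apply, Finset.sum_apply]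
    obtain ⟨m, hm, hm'⟩ := exists_missing y hy
    have hmx : m = x i := by
      by_contra hc
      obtain ⟨l, hl⟩ := hm' (x i) (Ne.symm hc)
      have : l ≠ i := by rintro rfl; exact hi hl.symm
      exact this (hx ((hij l this).trans hl))
    by_cases hk : k = m
    · subst hk
      rw [Finset.sum_eq_zero]
      · simp [hmx]
      · intro i _
        exact Pi.single_eq_of_ne (hm i).symm _
    · obtain ⟨l, rfl⟩ := hm' k hk
      rw [Finset.sum_eq_single l]
      · rw [hmx] at hk
        simp [Pi.single_eq_of_ne hk]
      · intro i' _ hi'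
        exact Pi.single_eq_of_ne (fun e => hi' (hy e.symm)) _
      · simp
  let v : Fin (n+1) → Fin (n+2) → ℤ := fun j => Pi.single (y j) 1
  have hyv : (fun j => (Pi.single (y j) 1 : Fin (n+2) → ℤ)) = v := rfl
  have hxv : (fun j => (Pi.single (x j) 1 : Fin (n+2) → ℤ)) = Function.update v i (Pi.single (x i) 1) := by
    funext j
    by_cases h : j = i
    · subst h; simp
    · simp [Function.update_of_ne h, v, hij j h]
  have hone : alt n (Function.update v i (fun _ => 1)) = 0 := by
    unfold alt
    rw [AlternatingMap.curryLeft_apply_apply]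
    refine AlternatingMap.map_eq_zero_of_eq _ _ (i := 0) (j := i.succ) ?_ (Fin.succ_ne_zero i).symm
    simp [Matrix.vecCons]
  have hsum : alt n (Function.update v i (∑ j, v j)) = alt n v := by
    rw [AlternatingMap.map_update_sum, Finset.sum_eq_single i]
    · simp
    · intro j _ hj
      exact AlternatingMap.map_update_self _ _ hj.symm
    · simp
  rw [h1, AlternatingMap.map_update_add] at hone
  simp only [D]
  rw [hxv, hyv]
  change _ + alt n (Function.update v i (∑ j, v j)) = 0 at hone
  rw [hsum] at hone
  linarith

/-- A signed orientation of the standard sphere. -/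
noncomputable def oStd (n : ℕ) (u : ℤ) (hu : u = 1 ∨ u = -1) :
    CoherentOrientation n (stdSphere n) where
  sign y := u * D n y
  sign_perm x σ := by rw [D_perm]; ring
  sign_unit x hx _ := by
    rcases D_unit x hx with h | h <;> rcases hu with h' | h' <;> simp [h, h']
  sign_zero x hx := by
    rw [D_zero, mul_zero]
    rcases hx with h | h
    · exact h
    · intro hinj
      apply h
      refine ⟨Finset.univ_nonempty.image _, fun he => ?_⟩
      have := Finset.card_image_of_injective Finset.univ hinj
      rw [he] at this
      simp at this
  coherent x y := by
    rintro ⟨i, hi, hij⟩ hx hy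
    have hxi : Function.Injective x := by
      by_contra h; exact hx (by rw [D_zero x h, mul_zero])
    have hyi : Function.Injective y := by
      by_contra h; exact hy (by rw [D_zero y h, mul_zero])
    rw [D_coh x y hxi hyi i hi hij]; ring

section cx

variable {V : Type*} {n d : ℕ}
  (ι : Fin (d+1) → Fin (n+2)) (e : Fin (n+2) ⊕ Fin (d+1) ≃ V)

/-- The boundary of the simplex, stacked over the facets indexed by the range of `ι`. -/
def cx : AbsCx V where
  faces := {s | s.Nonempty ∧ (∀ t, ¬ (e (.inl (ι t)) ∈ s ∧ e (.inr t) ∈ s)) ∧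
    (∀ t t', e (.inr t) ∈ s → e (.inr t') ∈ s → t = t') ∧
    ((∃ i, (∀ t, ι t ≠ i) ∧ e (.inl i) ∉ s) ∨
      ∃ i j, i ≠ j ∧ e (.inl i) ∉ s ∧ e (.inl j) ∉ s)}
  down_closed := by
    rintro s t ⟨_, ha, hb, hc⟩ hts ht
    refine ⟨ht, fun u h => ha u ⟨hts h.1, hts h.2⟩, fun u u' h h' => hb u u' (hts h) (hts h'), ?_⟩
    rcases hc with ⟨i, h, h'⟩ | ⟨i, j, h, h', h''⟩
    · exact .inl ⟨i, h, fun h => h' (hts h)⟩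
    · exact .inr ⟨i, j, h, fun h => h' (hts h), fun h => h'' (hts h)⟩
  nonempty_of_mem := fun s h => h.1

/-- The colouring. -/
def col (v : V) : Fin (n+2) := Sum.elim id ι (e.symm v)

/-- The sign of a vertex. -/
def eps (v : V) : ℤ := Sum.elim (fun _ : Fin (n+2) => 1) (fun _ : Fin (d+1) => -1) (e.symm v)

@[simp] theorem col_inl (i) : col ι e (e (.inl i)) = i := by simp [col]
@[simp] theorem col_inr (i) : col ι e (e (.inr i)) = ι i := by simp [col]
@[simp] theorem eps_inl (i) : eps e (e (.inl i)) = 1 := by simp [eps]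
@[simp] theorem eps_inr (i) : eps e (e (.inr i)) = -1 := by simp [eps]

theorem eps_unit (v : V) : eps e v = 1 ∨ eps e v = -1 := by
  obtain ⟨i | t, rfl⟩ := e.surjective v <;> simp

theorem vertexSet_cx (hn : 2 ≤ n) : (cx ι e).vertexSet = Set.univ := by
  ext v
  simp only [Set.mem_univ, iff_true]
  change ({v} : Finset V) ∈ (cx ι e).faces
  refine ⟨by simp, ?_, ?_, .inr ?_⟩
  · rintro t ⟨h, h'⟩
    simp only [Finset.mem_singleton] at h h'
    have := e.injective (h.trans h'.symm)
    simp at this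
  · intro t t' h h'
    simp only [Finset.mem_singleton] at h h'
    have := e.injective (h.trans h'.symm)
    simpa using this
  · obtain ⟨i | t, rfl⟩ := e.surjective v
    · have : 1 < (({i} : Finset (Fin (n+2)))ᶜ).card := by
        rw [Finset.card_compl]; simp; omega
      obtain ⟨a, ha, b, hb, hab⟩ := Finset.one_lt_card.mp this
      refine ⟨a, b, hab, ?_, ?_⟩ <;> simp_all
    · exact ⟨0, 1, by simp, by simp, by simp⟩

theorem simpl_cx : (cx ι e).IsSimplicialMap (stdSphere n) (col ι e) := by
  rintro s ⟨hne, ha, hb, hc⟩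
  refine ⟨hne.image _, fun hu => ?_⟩
  have key : ∀ i, e (.inl i) ∉ s → ∃ t, ι t = i ∧ e (.inr t) ∈ s := by
    intro i hi
    have : i ∈ s.image (col ι e) := by rw [hu]; simp
    obtain ⟨v, hv, hvi⟩ := Finset.mem_image.mp this
    obtain ⟨j | t, rfl⟩ := e.surjective v
    · simp at hvi; subst hvi; exact absurd hv hi
    · exact ⟨t, by simpa using hvi, hv⟩
  rcases hc with ⟨i, h, h'⟩ | ⟨i, j, h, h', h''⟩
  · obtain ⟨t, ht, _⟩ := key i h'
    exact h t ht
  · obtain ⟨t, ht, h1⟩ := key i h'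
    obtain ⟨t', ht', h2⟩ := key j h''
    exact h (by rw [← ht, ← ht', hb t t' h1 h2])

variable {ι} in
theorem col_injOn (hι : Function.Injective ι) {s : Finset V} (hs : s ∈ (cx ι e).faces)
    {u v : V} (hu : u ∈ s) (hv : v ∈ s) (h : col ι e u = col ι e v) : u = v := by
  obtain ⟨_, ha, hb, _⟩ := hs
  obtain ⟨i | t, rfl⟩ := e.surjective u <;> obtain ⟨i' | t', rfl⟩ := e.surjective v
  · simpa using h
  · simp at h; subst h; exact absurd ⟨hu, hv⟩ (ha t')
  · simp at h; subst h; exact absurd ⟨hv, hu⟩ (ha t)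
  · rw [hb t t' hu hv]

variable [DecidableEq V]

open scoped Classical in
/-- The orientation sign. -/
noncomputable def sgn (x : Fin (n+1) → V) : ℤ :=
  if Finset.image x Finset.univ ∈ (cx ι e).faces then
    (∏ i, eps e (x i)) * D n (col ι e ∘ x) else 0

theorem prod_eps_unit (x : Fin (n+1) → V) : (∏ i, eps e (x i)) = 1 ∨ (∏ i, eps e (x i)) = -1 := by
  apply Finset.prod_induction _ (fun z : ℤ => z = 1 ∨ z = -1)
  · rintro a b (rfl | rfl) (rfl | rfl) <;> simp
  · simp
  · intro i _; exact eps_unit e _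

/-- The mixed case of coherence cannot happen. -/
theorem mixed (x y : Fin (n+1) → V) (i : Fin (n+1))
    (hij : ∀ j, j ≠ i → x j = y j)
    (hx : Finset.image x Finset.univ ∈ (cx ι e).faces)
    (hy : Finset.image y Finset.univ ∈ (cx ι e).faces)
    (hcx : Function.Injective (col ι e ∘ x)) (hcy : Function.Injective (col ι e ∘ y))
    (p : Fin (n+2)) (q : Fin (d+1)) (hp : x i = e (.inl p)) (hq : y i = e (.inr q))
    (hpq : p ≠ ι q) : False := by
  have hmem : ∀ (z : Fin (n+1) → V) j, z j ∈ Finset.image z Finset.univ := fun z j =>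
    Finset.mem_image_of_mem _ (Finset.mem_univ _)
  -- all other vertices are base vertices
  have hbase : ∀ j, j ≠ i → x j = e (.inl (col ι e (x j))) := by
    intro j hj
    obtain ⟨a | t, ha⟩ := e.surjective (x j)
    · rw [← ha]; simp
    · exfalso
      have h1 := hmem y j
      have h2 := hmem y i
      rw [← hij j hj, ← ha] at h1
      rw [hq] at h2
      have := hy.2.2.1 _ _ h1 h2
      subst this
      have : y j = y i := by rw [← hij j hj, ← ha, hq]
      exact hj (hcy (by simp [this]))
  have hbase' : ∀ j, x j = e (.inl (col ι e (x j))) := by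
    intro j
    by_cases hj : j = i
    · subst hj; rw [hp]; simp
    · exact hbase j hj
  obtain ⟨m, hm, hm'⟩ := exists_missing _ hcx
  have hmq : m = ι q := by
    by_contra hc
    obtain ⟨l, hl⟩ := hm' (ι q) (Ne.symm hc)
    have hli : l ≠ i := by
      rintro rfl
      simp [hp] at hl
      exact hpq hl
    apply hli
    apply hcy
    simp only [Function.comp_apply] at hl ⊢
    rw [← hij l hli, hl, hq]; simp
  have hin : ∀ k, k ≠ m → e (.inl k) ∈ Finset.image x Finset.univ := by
    intro k hk
    obtain ⟨l, rfl⟩ := hm' k hk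
    have := hmem x l
    rw [hbase' l] at this
    exact this
  rcases hx.2.2.2 with ⟨a, h, h'⟩ | ⟨a, b, h, h', h''⟩
  · apply h'
    apply hin
    rw [hmq]; exact (h q).symm
  · by_cases ham : a = m
    · exact h'' (hin b (by rw [← ham]; exact h.symm))
    · exact h' (hin a ham)

/-- The orientation of the stacked sphere. -/
noncomputable def oCx (hι : Function.Injective ι) : CoherentOrientation n (cx ι e) where
  sign := sgn ι e
  sign_perm x σ := by
    have h1 : Finset.image (x ∘ σ) Finset.univ = Finset.image x Finset.univ := by
      rw [← Finset.image_image, Finset.image_univ_of_surjective σ.surjective]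
    have h2 : (∏ i, eps e ((x ∘ σ) i)) = ∏ i, eps e (x i) :=
      Equiv.prod_comp σ (fun i => eps e (x i))
    unfold sgn
    rw [h1, h2, ← Function.comp_assoc, D_perm]
    split_ifs
    · ring
    · simp
  sign_unit x hx hf := by
    unfold sgn
    rw [if_pos hf]
    have : Function.Injective (col ι e ∘ x) := fun a b h =>
      hx (col_injOn e hι hf (Finset.mem_image_of_mem _ (Finset.mem_univ _))
        (Finset.mem_image_of_mem _ (Finset.mem_univ _)) h)
    rcases D_unit _ this with h | h <;> rcases prod_eps_unit e x with h' | h' <;> rw [h, h'] <;> simp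
  sign_zero x hx := by
    unfold sgn
    split_ifs with hf
    · rcases hx with h | h
      · rw [D_zero, mul_zero]
        exact fun h' => h (Function.Injective.of_comp h')
      · exact absurd hf h
    · rfl
  coherent x y := by
    rintro ⟨i, hi, hij⟩ hx hy
    have hfx : Finset.image x Finset.univ ∈ (cx ι e).faces := by
      by_contra h; exact hx (if_neg h)
    have hfy : Finset.image y Finset.univ ∈ (cx ι e).faces := by
      by_contra h; exact hy (if_neg h)
    unfold sgn at *
    rw [if_pos hfx] at *
    rw [if_pos hfy] at *
    have hcx : Function.Injective (col ι e ∘ x) := by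
      by_contra h; exact hx (by rw [D_zero _ h, mul_zero])
    have hcy : Function.Injective (col ι e ∘ y) := by
      by_contra h; exact hy (by rw [D_zero _ h, mul_zero])
    have hpx : (∏ j, eps e (x j)) = eps e (x i) * ∏ j ∈ Finset.univ.erase i, eps e (x j) :=
      (Finset.mul_prod_erase _ _ (Finset.mem_univ i)).symm
    have hpy : (∏ j, eps e (y j)) = eps e (y i) * ∏ j ∈ Finset.univ.erase i, eps e (x j) := by
      rw [← Finset.mul_prod_erase _ _ (Finset.mem_univ i)]
      congr 1
      apply Finset.prod_congr rfl
      intro j hj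
      rw [hij j (Finset.ne_of_mem_erase hj)]
    rw [hpx, hpy]
    by_cases hc : col ι e (x i) = col ι e (y i)
    · have : col ι e ∘ x = col ι e ∘ y := by
        funext j
        by_cases hj : j = i
        · subst hj; exact hc
        · simp [hij j hj]
      rw [this]
      have : eps e (y i) = - eps e (x i) := by
        obtain ⟨a | t, ha⟩ := e.surjective (x i) <;> obtain ⟨a' | t', ha'⟩ := e.surjective (y i) <;>
          rw [← ha, ← ha'] at hc hi ⊢
        · simp at hc; subst hc; exact absurd rfl hi
        · simp
        · simp
        · simp at hc; rw [hι hc] at hi; exact absurd rfl hi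
      rw [this]; ring
    · have hD := D_coh (col ι e ∘ x) (col ι e ∘ y) hcx hcy i hc (fun j hj => by simp [hij j hj])
      have : eps e (y i) = eps e (x i) := by
        obtain ⟨a | t, ha⟩ := e.surjective (x i) <;> obtain ⟨a' | t', ha'⟩ := e.surjective (y i)
        · simp [← ha, ← ha']
        · exact (mixed ι e x y i hij hfx hfy hcx hcy a t' ha.symm ha'.symm
            (by simpa [← ha, ← ha'] using hc)).elim
        · exact (mixed ι e y x i (fun j hj => (hij j hj).symm) hfy hfx hcy hcx a' t ha'.symm ha.symm
            (by simpa [← ha, ← ha'] using Ne.symm hc)).elim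
        · simp [← ha, ← ha']
      rw [this, hD]; ring


/-! ### Degree -/

/-- Lift of a colour tuple using the stacking vertex `t`. -/
def lift (y : Fin (n+1) → Fin (n+2)) (t : Fin (d+1)) : Fin (n+1) → V :=
  fun i => if y i = ι t then e (.inr t) else e (.inl (y i))

theorem col_lift (y : Fin (n+1) → Fin (n+2)) (t : Fin (d+1)) :
    col ι e ∘ lift ι e y t = y := by
  funext i
  simp only [lift, Function.comp_apply]
  split_ifs with h <;> simp [h]

theorem face_lift (y : Fin (n+1) → Fin (n+2)) (t : Fin (d+1))
    (j : Fin (n+2)) (hj : ∀ i, y i ≠ j) (hjt : j ≠ ι t) :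
    Finset.image (lift ι e y t) Finset.univ ∈ (cx ι e).faces := by
  have hinr : ∀ t', e (.inr t') ∈ Finset.image (lift ι e y t) Finset.univ → t' = t := by
    intro t' h
    obtain ⟨i, _, hi⟩ := Finset.mem_image.mp h
    simp only [lift] at hi
    split_ifs at hi
    · have := e.injective hi; simp at this; exact this.symm
    · have := e.injective hi; simp at this
  have hinl : ∀ k, e (.inl k) ∈ Finset.image (lift ι e y t) Finset.univ → k ≠ ι t ∧ k ≠ j := by
    intro k h
    obtain ⟨i, _, hi⟩ := Finset.mem_image.mp h
    simp only [lift] at hi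
    split_ifs at hi with h1
    · have := e.injective hi; simp at this
    · have := e.injective hi; simp at this; subst this; exact ⟨h1, hj i⟩
  refine ⟨Finset.univ_nonempty.image _, ?_, ?_, .inr ⟨j, ι t, hjt, ?_, ?_⟩⟩
  · rintro t' ⟨h, h'⟩
    have := hinr t' h'
    subst this
    exact (hinl _ h).1 rfl
  · intro a b ha hb
    rw [hinr a ha, hinr b hb]
  · intro h; exact (hinl _ h).2 rfl
  · intro h; exact (hinl _ h).1 rfl

theorem eps_lift (y : Fin (n+1) → Fin (n+2)) (hy : Function.Injective y) (t : Fin (d+1))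
    (ht : ∃ i, y i = ι t) :
    ∏ i, eps e (lift ι e y t i) = -1 := by
  obtain ⟨i, hi⟩ := ht
  rw [Finset.prod_eq_single i]
  · simp [lift, hi]
  · intro b _ hb
    have : y b ≠ ι t := fun h => hb (hy (h.trans hi.symm))
    simp [lift, this]
  · simp

theorem lifts (hι : Function.Injective ι) (x : Fin (n+1) → V)
    (hf : Finset.image x Finset.univ ∈ (cx ι e).faces) :
    (x = fun i => e (.inl (col ι e (x i)))) ∨
      ∃ t, (∃ i, col ι e (x i) = ι t) ∧ x = lift ι e (col ι e ∘ x) t := by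
  have hmem : ∀ j, x j ∈ Finset.image x Finset.univ := fun j =>
    Finset.mem_image_of_mem _ (Finset.mem_univ _)
  by_cases h : ∃ i t, x i = e (.inr t)
  · right
    obtain ⟨i, t, hit⟩ := h
    refine ⟨t, ⟨i, by rw [hit]; simp⟩, ?_⟩
    funext l
    simp only [lift, Function.comp_apply]
    split_ifs with hl
    · rw [← hit]
      exact col_injOn e hι hf (hmem l) (hmem i) (by rw [hl, hit]; simp)
    · obtain ⟨a | t', ha⟩ := e.surjective (x l)
      · rw [← ha]; simp
      · exfalso
        have h1 := hmem l
        have h2 := hmem i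
        rw [← ha] at h1
        rw [hit] at h2
        rw [hf.2.2.1 _ _ h1 h2] at ha
        rw [← ha] at hl
        simp at hl
  · left
    push Not at h
    funext l
    obtain ⟨a | t', ha⟩ := e.surjective (x l)
    · rw [← ha]; simp
    · exact absurd ha.symm (h l t')

theorem face_base (y : Fin (n+1) → Fin (n+2)) (j : Fin (n+2)) (hj : ∀ i, y i ≠ j)
    (hj' : ∀ k, k ≠ j → ∃ i, y i = k) :
    Finset.image (fun i => e (.inl (y i))) Finset.univ ∈ (cx ι e).faces ↔ ∀ t, ι t ≠ j := by
  constructor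
  · rintro ⟨_, _, _, hc⟩ t rfl
    have hin : ∀ k, k ≠ ι t → e (.inl k) ∈ Finset.image (fun i => e (.inl (y i))) Finset.univ := by
      intro k hk
      obtain ⟨i, rfl⟩ := hj' k hk
      exact Finset.mem_image_of_mem (fun i => e (.inl (y i))) (Finset.mem_univ i)
    rcases hc with ⟨a, h, h'⟩ | ⟨a, b, h, h', h''⟩
    · exact h' (hin a (h t).symm)
    · by_cases ham : a = ι t
      · exact h'' (hin b (by rw [← ham]; exact h.symm))
      · exact h' (hin a ham)
  · intro h
    refine ⟨Finset.univ_nonempty.image _, ?_, ?_, .inl ⟨j, h, ?_⟩⟩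
    · rintro t ⟨_, h⟩
      simp at h
    · intro t t' h
      simp at h
    · simpa using hj

theorem algSum_cx [Fintype V] (hι : Function.Injective ι) (y : Fin (n+1) → Fin (n+2))
    (hy : Function.Injective y) :
    algSum (sgn ι e) (col ι e) y = - d * D n y := by
  classical
  obtain ⟨j, hj, hj'⟩ := exists_missing y hy
  let x0 : Fin (n+1) → V := fun i => e (.inl (y i))
  let B : Finset (Fin (n+1) → V) :=
    (Finset.univ.filter (fun t => ι t ≠ j)).image (lift ι e y)
  have hcol0 : col ι e ∘ x0 = y := by funext i; simp [x0]
  have hx0B : x0 ∉ B := by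
    intro h
    obtain ⟨t, ht, h⟩ := Finset.mem_image.mp h
    obtain ⟨i, hi⟩ := hj' (ι t) (by simpa using ht)
    have := congrFun h i
    simp [lift, hi, x0] at this
  have hsum : algSum (sgn ι e) (col ι e) y = ∑ x ∈ insert x0 B, sgn ι e x := by
    unfold algSum
    have hfil : (∑ x : Fin (n+1) → V, if col ι e ∘ x = y then sgn ι e x else 0) =
        ∑ x ∈ Finset.univ.filter (fun x : Fin (n+1) → V => col ι e ∘ x = y), sgn ι e x := by
      rw [Finset.sum_filter]
    refine Eq.trans ?_ (hfil.trans ?_)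
    · apply Finset.sum_congr rfl
      intro x _
      congr
    symm
    apply Finset.sum_subset
    · intro x hx
      rw [Finset.mem_insert] at hx
      simp only [Finset.mem_filter, Finset.mem_univ, true_and]
      rcases hx with rfl | hx
      · exact hcol0
      · obtain ⟨t, _, rfl⟩ := Finset.mem_image.mp hx
        exact col_lift ι e y t
    · intro x hx hxn
      simp only [Finset.mem_filter, Finset.mem_univ, true_and] at hx
      unfold sgn
      rw [if_neg]
      intro hf
      apply hxn
      rw [Finset.mem_insert]
      rcases lifts ι e hι x hf with h | ⟨t, ⟨i, hi⟩, h⟩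
      · left
        rw [h]
        funext i
        simp [x0, ← hx]
      · right
        refine Finset.mem_image.mpr ⟨t, ?_, ?_⟩
        · simp only [Finset.mem_filter, Finset.mem_univ, true_and]
          rw [← hi]
          exact fun h' => hj i (by rw [← hx]; exact h')
        · rw [h, hx]
  have hinj : ∀ t ∈ Finset.univ.filter (fun t => ι t ≠ j), ∀ t' ∈ Finset.univ.filter (fun t => ι t ≠ j),
      lift ι e y t = lift ι e y t' → t = t' := by
    intro t ht t' ht' h
    obtain ⟨i, hi⟩ := hj' (ι t) (by simpa using ht)
    have := congrFun h i
    simp only [lift, hi, if_true] at this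
    split_ifs at this with h1
    · exact hι h1
    · have := e.injective this; simp at this
  have hB : ∑ x ∈ B, sgn ι e x = - ((Finset.univ.filter (fun t => ι t ≠ j)).card : ℤ) * D n y := by
    rw [Finset.sum_image hinj, Finset.sum_congr rfl (g := fun _ => - D n y)]
    · simp
    · intro t ht
      have ht' : ι t ≠ j := by simpa using ht
      unfold sgn
      rw [if_pos (face_lift ι e y t j hj ht'.symm), eps_lift ι e y hy t (hj' _ ht'), col_lift]
      ring
  have h0 : sgn ι e x0 = if ∀ t, ι t ≠ j then D n y else 0 := by
    unfold sgn
    simp only [x0, face_base ι e y j hj hj']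
    split_ifs
    · rw [hcol0]; simp
    · rfl
  rw [hsum, Finset.sum_insert hx0B, hB, h0]
  split_ifs with h
  · rw [Finset.filter_true_of_mem (fun t _ => h t)]
    simp
    ring
  · push Not at h
    obtain ⟨t, rfl⟩ := h
    have : Finset.univ.filter (fun t' => ι t' ≠ ι t) = Finset.univ.erase t := by
      ext t'
      simp [hι.eq_iff]
    rw [this, Finset.card_erase_of_mem (Finset.mem_univ _)]
    simp

/-! ### The homeomorphism -/

end cx

section homeo

variable {V : Type*} {n d : ℕ}
  (ι : Fin (d+1) → Fin (n+2)) (e : Fin (n+2) ⊕ Fin (d+1) ≃ V)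

/-- Signed coordinates. -/
noncomputable def X (g : V → ℝ) (i : Fin (n+2)) : ℝ :=
  g (e (.inl i)) - ∑ t, if ι t = i then g (e (.inr t)) else 0

theorem X_of_notMem (g : V → ℝ) (i : Fin (n+2)) (hi : ∀ t, ι t ≠ i) :
    X ι e g i = g (e (.inl i)) := by
  simp [X, hi]

variable {ι} in
theorem X_of_mem (hι : Function.Injective ι) (g : V → ℝ) (t : Fin (d+1)) :
    X ι e g (ι t) = g (e (.inl (ι t))) - g (e (.inr t)) := by
  simp [X, hι.eq_iff]

theorem X_smul (c : ℝ) (g : V → ℝ) (i : Fin (n+2)) : X ι e (c • g) i = c * X ι e g i := by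
  simp [X, mul_sub, Finset.mul_sum]

theorem X_le (g : V → ℝ) (hg : ∀ v, 0 ≤ g v) (i : Fin (n+2)) : X ι e g i ≤ g (e (.inl i)) := by
  have : 0 ≤ ∑ t, if ι t = i then g (e (.inr t)) else 0 :=
    Finset.sum_nonneg (fun t _ => by split_ifs <;> simp [hg])
  simp only [X]; linarith

/-- The support of `g` is a face (or empty). -/
def Good (g : V → ℝ) : Prop :=
  (∀ v, 0 ≤ g v) ∧ (∀ t, g (e (.inl (ι t))) = 0 ∨ g (e (.inr t)) = 0) ∧
  (∀ t t', g (e (.inr t)) ≠ 0 → g (e (.inr t')) ≠ 0 → t = t') ∧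
  ((∃ i, (∀ t, ι t ≠ i) ∧ g (e (.inl i)) = 0) ∨
      ∃ i j, i ≠ j ∧ g (e (.inl i)) = 0 ∧ g (e (.inl j)) = 0)

theorem Good.smul {g : V → ℝ} (h : Good ι e g) {c : ℝ} (hc : 0 ≤ c) : Good ι e (c • g) := by
  obtain ⟨h1, h2, h3, h4⟩ := h
  refine ⟨fun v => mul_nonneg hc (h1 v), fun t => (h2 t).imp ?_ ?_, fun t t' h h' => ?_, ?_⟩
  · intro h; simp [h]
  · intro h; simp [h]
  · simp at h h'; exact h3 t t' h.2 h'.2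
  · rcases h4 with ⟨i, h, h'⟩ | ⟨i, j, h, h', h''⟩
    · exact .inl ⟨i, h, by simp [h']⟩
    · exact .inr ⟨i, j, h, by simp [h'], by simp [h'']⟩

theorem mem_realization [Fintype V] (g : V → ℝ) :
    g ∈ (cx ι e).realization ↔ Good ι e g ∧ ∑ v, g v = 1 := by
  classical
  constructor
  · rintro ⟨h0, s, ⟨hne, ha, hb, hc⟩, hs, hsum⟩
    refine ⟨⟨h0, ?_, ?_, ?_⟩, ?_⟩
    · intro t
      by_contra! h
      exact ha t ⟨by_contra fun h' => h.1 (hs _ h'), by_contra fun h' => h.2 (hs _ h')⟩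
    · intro t t' h h'
      exact hb t t' (by_contra fun h1 => h (hs _ h1)) (by_contra fun h1 => h' (hs _ h1))
    · rcases hc with ⟨i, h, h'⟩ | ⟨i, j, h, h', h''⟩
      · exact .inl ⟨i, h, hs _ h'⟩
      · exact .inr ⟨i, j, h, hs _ h', hs _ h''⟩
    · rw [← hsum]
      symm
      exact Finset.sum_subset (Finset.subset_univ _) (fun v _ hv => hs v hv)
  · rintro ⟨⟨h0, ha, hb, hc⟩, hsum⟩
    have hsum' : ∑ v ∈ Finset.univ.filter (fun v => g v ≠ 0), g v = 1 := by
      rw [Finset.sum_filter_ne_zero, hsum]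
    refine ⟨h0, Finset.univ.filter (fun v => g v ≠ 0), ⟨?_, ?_, ?_, ?_⟩, ?_, hsum'⟩
    · by_contra h
      rw [Finset.not_nonempty_iff_eq_empty] at h
      rw [h] at hsum'
      simp at hsum'
    · rintro t ⟨h, h'⟩
      simp only [Finset.mem_filter, Finset.mem_univ, true_and] at h h'
      rcases ha t with h1 | h1
      · exact h h1
      · exact h' h1
    · intro t t' h h'
      simp only [Finset.mem_filter, Finset.mem_univ, true_and] at h h'
      exact hb t t' h h'
    · rcases hc with ⟨i, h, h'⟩ | ⟨i, j, h, h', h''⟩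
      · exact .inl ⟨i, h, by simp [h']⟩
      · exact .inr ⟨i, j, h, by simp [h'], by simp [h'']⟩
    · intro v hv
      simpa using hv

variable {ι} in
theorem Good.aux (hι : Function.Injective ι) {g g' : V → ℝ} (h : Good ι e g) (h' : Good ι e g')
    (c : ℝ) (hc : 0 < c) (hX : ∀ i, X ι e g i = X ι e g' i + c) : False := by
  have neg : ∀ i, g (e (.inl i)) = 0 → ∃ t, ι t = i ∧ g' (e (.inr t)) ≠ 0 := by
    intro i hi
    have h1 := X_le ι e g h.1 i
    rw [hi, hX i] at h1
    by_cases hm : ∃ t, ι t = i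
    · obtain ⟨t, rfl⟩ := hm
      refine ⟨t, rfl, fun h2 => ?_⟩
      rw [X_of_mem e hι, h2] at h1
      have := h'.1 (e (.inl (ι t)))
      linarith
    · push Not at hm
      rw [X_of_notMem ι e g' i hm] at h1
      have := h'.1 (e (.inl i))
      linarith
  rcases h.2.2.2 with ⟨i, h1, h2⟩ | ⟨i, j, hij, hi, hj⟩
  · obtain ⟨t, ht, _⟩ := neg i h2
    exact h1 t ht
  · obtain ⟨t, ht, h1⟩ := neg i hi
    obtain ⟨t', ht', h2⟩ := neg j hj
    exact hij (by rw [← ht, ← ht', h'.2.2.1 t t' h1 h2])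

variable {ι} in
theorem Good.unique (hι : Function.Injective ι) {g g' : V → ℝ} (h : Good ι e g)
    (h' : Good ι e g') (c : ℝ) (hX : ∀ i, X ι e g i = X ι e g' i + c) : g = g' := by
  have hc : c = 0 := by
    rcases lt_trichotomy c 0 with hc | hc | hc
    · exact (Good.aux e hι h' h (-c) (by linarith) (fun i => by rw [hX i]; ring)).elim
    · exact hc
    · exact (Good.aux e hι h h' c hc hX).elim
  subst hc
  have key : ∀ t, g (e (.inl (ι t))) = g' (e (.inl (ι t))) ∧ g (e (.inr t)) = g' (e (.inr t)) := by
    intro t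
    have h1 := hX (ι t)
    rw [X_of_mem e hι, X_of_mem e hι] at h1
    have a1 := h.1 (e (.inl (ι t)))
    have a2 := h.1 (e (.inr t))
    have a3 := h'.1 (e (.inl (ι t)))
    have a4 := h'.1 (e (.inr t))
    rcases h.2.1 t with h2 | h2 <;> rcases h'.2.1 t with h3 | h3 <;> constructor <;> linarith
  funext v
  obtain ⟨i | t, rfl⟩ := e.surjective v
  · by_cases hm : ∃ t, ι t = i
    · obtain ⟨t, rfl⟩ := hm
      exact (key t).1
    · push Not at hm
      have := hX i
      rw [X_of_notMem ι e g i hm, X_of_notMem ι e g' i hm] at this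
      linarith
  · exact (key t).2

theorem exists_level (x : Fin (n+2) → ℝ) : ∃ c : ℝ,
    ((∃ i, (∀ t, ι t ≠ i) ∧ x i ≤ c) ∨ ∃ i j, i ≠ j ∧ x i ≤ c ∧ x j ≤ c) ∧
    (∀ i, x i < c → ∃ t, ι t = i) ∧ (∀ i j, x i < c → x j < c → i = j) := by
  obtain ⟨i0, -, h0⟩ := Finset.exists_min_image Finset.univ x Finset.univ_nonempty
  by_cases hm : ∃ t, ι t = i0
  · have hne : (Finset.univ.erase i0).Nonempty := by
      rw [← Finset.card_pos, Finset.card_erase_of_mem (Finset.mem_univ _)]; simp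
    obtain ⟨i1, hi1, h1⟩ := Finset.exists_min_image (Finset.univ.erase i0) x hne
    have key : ∀ i, x i < x i1 → i = i0 := by
      intro i hi
      by_contra hc
      have := h1 i (Finset.mem_erase.mpr ⟨hc, Finset.mem_univ _⟩)
      linarith
    refine ⟨x i1, .inr ⟨i0, i1, (Finset.ne_of_mem_erase hi1).symm, h0 _ (Finset.mem_univ _), le_rfl⟩,
      fun i hi => ?_, fun i j hi hj => ?_⟩
    · rw [key i hi]; exact hm
    · rw [key i hi, key j hj]
  · push Not at hm
    refine ⟨x i0, .inl ⟨i0, hm, le_rfl⟩, fun i hi => ?_, fun i j hi _ => ?_⟩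
    · exact absurd hi (not_lt.mpr (h0 i (Finset.mem_univ _)))
    · exact absurd hi (not_lt.mpr (h0 i (Finset.mem_univ _)))

variable {ι} in
theorem exists_good (hι : Function.Injective ι) (x : Fin (n+2) → ℝ) :
    ∃ g c, Good ι e g ∧ ∀ i, X ι e g i = x i + c := by
  obtain ⟨c, hP, hQ, hQ'⟩ := exists_level ι x
  let g : V → ℝ := fun v =>
    Sum.elim (fun i => max (x i - c) 0) (fun t => max (c - x (ι t)) 0) (e.symm v)
  have gl : ∀ i, g (e (.inl i)) = max (x i - c) 0 := fun i => by simp [g]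
  have gr : ∀ t, g (e (.inr t)) = max (c - x (ι t)) 0 := fun t => by simp [g]
  have gr' : ∀ t, g (e (.inr t)) ≠ 0 → x (ι t) < c := by
    intro t h
    by_contra hc
    exact h (by rw [gr]; exact max_eq_right (by linarith))
  refine ⟨g, -c, ⟨?_, ?_, ?_, ?_⟩, ?_⟩
  · intro v
    obtain ⟨i | t, rfl⟩ := e.surjective v
    · rw [gl]; exact le_max_right _ _
    · rw [gr]; exact le_max_right _ _
  · intro t
    rcases le_total (x (ι t)) c with h | h
    · left; rw [gl]; exact max_eq_right (by linarith)
    · right; rw [gr]; exact max_eq_right (by linarith)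
  · intro t t' h h'
    exact hι (hQ' _ _ (gr' t h) (gr' t' h'))
  · rcases hP with ⟨i, h, h'⟩ | ⟨i, j, h, h', h''⟩
    · exact .inl ⟨i, h, by rw [gl]; exact max_eq_right (by linarith)⟩
    · exact .inr ⟨i, j, h, by rw [gl]; exact max_eq_right (by linarith),
        by rw [gl]; exact max_eq_right (by linarith)⟩
  · intro i
    by_cases hm : ∃ t, ι t = i
    · obtain ⟨t, rfl⟩ := hm
      rw [X_of_mem e hι, gl, gr]
      rcases le_total (x (ι t)) c with h | h
      · rw [max_eq_right, max_eq_left] <;> linarith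
      · rw [max_eq_left, max_eq_right] <;> linarith
    · rw [X_of_notMem ι e g i (by simpa using hm), gl, max_eq_left]
      · ring
      · by_contra hc
        exact hm (hQ i (by linarith))

/-- The piecewise linear map to Euclidean space. -/
noncomputable def Phi (g : V → ℝ) : EuclideanSpace ℝ (Fin (n+1)) :=
  WithLp.toLp 2 (fun j => X ι e g j.succ - X ι e g 0)

theorem Phi_smul (c : ℝ) (g : V → ℝ) : Phi ι e (c • g) = c • Phi ι e g := by
  ext j
  simp [Phi, X_smul, mul_sub]

theorem continuous_Phi : Continuous (Phi ι e) := by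
  unfold Phi X
  apply (PiLp.continuous_toLp 2 _).comp
  apply continuous_pi
  intro j
  apply Continuous.sub <;>
  · apply Continuous.sub (continuous_apply _)
    apply continuous_finsetSum
    intro t _
    split_ifs
    · exact continuous_apply _
    · exact continuous_const

variable {ι} in
theorem Phi_inj (hι : Function.Injective ι) {g g' : V → ℝ} (h : Good ι e g)
    (h' : Good ι e g') (hP : Phi ι e g = Phi ι e g') : g = g' := by
  refine Good.unique e hι h h' (X ι e g 0 - X ι e g' 0) ?_
  refine Fin.cases (by ring) (fun j => ?_)
  have := congrArg (fun z : EuclideanSpace ℝ (Fin (n+1)) => z j) hP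
  simp only [Phi] at this
  linarith

theorem Good_zero : Good ι e (0 : V → ℝ) :=
  ⟨fun _ => le_rfl, fun _ => .inl rfl, fun _ _ h => absurd rfl h, .inr ⟨0, 1, by simp, rfl, rfl⟩⟩

theorem Phi_zero : Phi ι e (0 : V → ℝ) = 0 := by
  ext j; simp [Phi, X]

variable {ι} in
theorem Phi_ne [Fintype V] (hι : Function.Injective ι) {g : V → ℝ}
    (h : g ∈ (cx ι e).realization) : Phi ι e g ≠ 0 := by
  rw [mem_realization] at h
  intro h0
  have := Phi_inj e hι h.1 (Good_zero ι e) (h0.trans (Phi_zero ι e).symm)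
  rw [this] at h
  simpa using h.2

theorem compact_realization {V : Type*} [Fintype V] (K : AbsCx V) : IsCompact K.realization := by
  classical
  have : K.realization = ⋃ s ∈ K.faces, {g : V → ℝ | (∀ v, g v ∈ Set.Icc (0:ℝ) 1) ∧
      (∀ v, v ∉ s → g v = 0) ∧ ∑ v ∈ s, g v = 1} := by
    ext g
    simp only [Set.mem_iUnion, Set.mem_setOf_eq, realization]
    constructor
    · rintro ⟨h0, s, hs, h1, h2⟩
      refine ⟨s, hs, fun v => ⟨h0 v, ?_⟩, h1, h2⟩
      by_cases hv : v ∈ s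
      · rw [← h2]; exact Finset.single_le_sum (fun v _ => h0 v) hv
      · rw [h1 v hv]; exact zero_le_one
    · rintro ⟨s, hs, h0, h1, h2⟩
      exact ⟨fun v => (h0 v).1, s, hs, h1, h2⟩
  rw [this]
  apply (Set.toFinite _).isCompact_biUnion
  intro s _
  apply IsCompact.of_isClosed_subset (isCompact_univ_pi (fun _ : V => isCompact_Icc (a := (0:ℝ)) (b := 1)))
  · simp only [Set.setOf_and, Set.setOf_forall]
    refine IsClosed.inter ?_ (IsClosed.inter ?_ ?_)
    · exact isClosed_iInter fun v => isClosed_Icc.preimage (continuous_apply v)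
    · exact isClosed_iInter fun v => isClosed_iInter fun _ =>
        isClosed_eq (continuous_apply v) continuous_const
    · exact isClosed_eq (continuous_finsetSum _ (fun v _ => continuous_apply v)) continuous_const
  · intro g hg v _
    exact hg.1 v

variable {ι} in
theorem sphere_cx [Fintype V] (hι : Function.Injective ι) :
    (cx ι e).IsSphereTriangulation n := by
  have : CompactSpace (cx ι e).realization := isCompact_iff_compactSpace.mp (compact_realization _)
  let F : (cx ι e).realization → Metric.sphere (0 : EuclideanSpace ℝ (Fin (n+1))) 1 :=
    fun g => ⟨‖Phi ι e g.1‖⁻¹ • Phi ι e g.1, by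
      rw [mem_sphere_zero_iff_norm, norm_smul, norm_inv, norm_norm,
        inv_mul_cancel₀ (norm_ne_zero_iff.mpr (Phi_ne e hι g.2))]⟩
  have hF : Continuous F := by
    apply Continuous.subtype_mk
    have h1 : Continuous fun g : (cx ι e).realization => Phi ι e g.1 :=
      (continuous_Phi ι e).comp continuous_subtype_val
    exact (h1.norm.inv₀ (fun g => norm_ne_zero_iff.mpr (Phi_ne e hι g.2))).smul h1
  have hinj : Function.Injective F := by
    rintro ⟨g, hg⟩ ⟨g', hg'⟩ h
    have h1 : ‖Phi ι e g‖⁻¹ • Phi ι e g = ‖Phi ι e g'‖⁻¹ • Phi ι e g' := congrArg Subtype.val h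
    have p := norm_pos_iff.mpr (Phi_ne e hι hg)
    have p' := norm_pos_iff.mpr (Phi_ne e hι hg')
    rw [← Phi_smul, ← Phi_smul] at h1
    rw [mem_realization] at hg hg'
    have h2 := Phi_inj e hι (hg.1.smul ι e (inv_nonneg.mpr p.le)) (hg'.1.smul ι e (inv_nonneg.mpr p'.le)) h1
    have h3 : ∑ v, (‖Phi ι e g‖⁻¹ • g) v = ∑ v, (‖Phi ι e g'‖⁻¹ • g') v := by rw [h2]
    simp only [Pi.smul_apply, smul_eq_mul, ← Finset.mul_sum, hg.2, hg'.2, mul_one] at h3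
    rw [h3] at h2
    exact Subtype.ext (smul_right_injective _ (inv_ne_zero p'.ne') h2)
  have hsurj : Function.Surjective F := by
    rintro ⟨u, hu⟩
    rw [mem_sphere_zero_iff_norm] at hu
    obtain ⟨g, c, hg, hX⟩ := exists_good e hι (Fin.cons 0 (fun j => u j))
    have hP : Phi ι e g = u := by
      ext j
      simp [Phi, hX]
    have hpos : 0 < ∑ v, g v := by
      rcases (Finset.sum_nonneg (fun v _ => hg.1 v) : 0 ≤ ∑ v, g v).lt_or_eq with h | h
      · exact h
      · exfalso
        have h1 := (Finset.sum_eq_zero_iff_of_nonneg (fun v _ => hg.1 v)).mp h.symm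
        have : g = 0 := funext fun v => h1 v (Finset.mem_univ v)
        rw [this, Phi_zero] at hP
        rw [← hP] at hu
        simp at hu
    refine ⟨⟨(∑ v, g v)⁻¹ • g, ?_⟩, ?_⟩
    · rw [mem_realization]
      refine ⟨hg.smul ι e (inv_nonneg.mpr hpos.le), ?_⟩
      simp only [Pi.smul_apply, smul_eq_mul, ← Finset.mul_sum]
      exact inv_mul_cancel₀ hpos.ne'
    · apply Subtype.ext
      change ‖Phi ι e ((∑ v, g v)⁻¹ • g)‖⁻¹ • Phi ι e ((∑ v, g v)⁻¹ • g) = u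
      rw [Phi_smul, hP, norm_smul, hu, mul_one, norm_inv, Real.norm_eq_abs, abs_of_pos hpos, inv_inv,
        smul_smul, mul_inv_cancel₀ hpos.ne', one_smul]
  exact ⟨Continuous.homeoOfEquivCompactToT2 (f := Equiv.ofBijective F ⟨hinj, hsurj⟩) hF⟩

end homeo

end Constr

/-- For `|k| ≥ 2` and `n ≥ |k|` there is a triangulated `n`-sphere with `|k| + n + 3`
vertices admitting a simplicial degree `k` map to `S^n_{n+2}`. -/
theorem stmt10 (k : ℤ) (hk : 2 ≤ k.natAbs) (n : ℕ) (hn : k.natAbs ≤ n) :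
    ∃ K : AbsCx (Fin (k.natAbs + n + 3)),
      K.vertexSet = Set.univ ∧ K.IsSphereTriangulation n ∧
      ∃ (oK : CoherentOrientation n K) (oL : CoherentOrientation n (stdSphere n))
        (f : Fin (k.natAbs + n + 3) → Fin (n + 2)),
        K.IsSimplicialMap (stdSphere n) f ∧ HasDegree oK oL f k := by
  let ι : Fin (k.natAbs + 1) → Fin (n + 2) := Fin.castLE (by omega)
  have hι : Function.Injective ι := Fin.castLE_injective _
  let e : Fin (n+2) ⊕ Fin (k.natAbs + 1) ≃ Fin (k.natAbs + n + 3) :=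
    finSumFinEquiv.trans (finCongr (by omega))
  have hu : ∃ u : ℤ, (u = 1 ∨ u = -1) ∧ - (k.natAbs : ℤ) = k * u := by
    rcases Int.natAbs_eq k with h | h
    · exact ⟨-1, .inr rfl, by omega⟩
    · exact ⟨1, .inl rfl, by omega⟩
  obtain ⟨u, hu, huk⟩ := hu
  refine ⟨Constr.cx ι e, Constr.vertexSet_cx ι e (by omega), Constr.sphere_cx e hι,
    Constr.oCx ι e hι, Constr.oStd n u hu, Constr.col ι e, Constr.simpl_cx ι e, ?_⟩
  intro y hy
  change u * Constr.D n y = 1 at hy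
  have hinj : Function.Injective y := by
    by_contra h
    rw [Constr.D_zero y h] at hy
    simp at hy
  change algSum (Constr.sgn ι e) (Constr.col ι e) y = k
  rw [Constr.algSum_cx ι e hι y hinj, huk, mul_assoc, hy, mul_one]
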